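/- (Generic functional bound for the provisional algorithm.) Let F = f + g with f convex, L-Lipschitz gradient, g proper convex lsc, x⋆ a minimizer of F, γ > 0, and (t_k) satisfying t_k² − t_k ≤ t_{k−1}² with t₀ = 1. Consider iterates y_k = x_k + α_k(x_k − x_{k−1}) if b_k = 1 and y_k = x_k otherwise (b_k ∈ {0,1}, α_k = (t_{k−1}−1)/t_k), followed by x_{k+1} = prox_{γg}(y_k − γ∇f(y_k)). Then for all n: t_n² (F(x_{n+1}) − F⋆) ≤ −∑_{k=0}^{n} ((1−γL)/(2γ)) t_k² ‖x_{k+1} − y_k‖² + (1/(2γ))‖x₀ − x⋆‖² + ∑_{k=1}^{n} (1 − b_k)(1/(2γ))‖x_k − x⋆‖². -/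

import Mathlib

noncomputable section

section helpers
variable {E : Type*} [NormedAddCommGroup E] [InnerProductSpace ℝ E] [CompleteSpace E]

lemma aux_line_deriv (f : E → ℝ) (f' : E → E) (hf' : ∀ z, HasGradientAt f (f' z) z)
    (y d : E) (s : ℝ) :
    HasDerivAt (fun s : ℝ => f (y + s • d)) (inner ℝ (f' (y + s • d)) d) s := by
  have h1 : HasDerivAt (fun s : ℝ => y + s • d) d s := by
    simpa using ((hasDerivAt_id s).smul_const d).const_add y
  have h2 := (hf' (y + s • d)).hasFDerivAt.comp_hasDerivAt s h1
  simp only [InnerProductSpace.toDual_apply_apply] at h2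
  exact h2

lemma aux_convex (f : E → ℝ) (f' : E → E) (hc : ConvexOn ℝ Set.univ f)
    (hf' : ∀ z, HasGradientAt f (f' z) z) (y z : E) :
    f y + inner ℝ (f' y) (z - y) ≤ f z := by
  have hφ : ConvexOn ℝ Set.univ (fun s : ℝ => f (y + s • (z - y))) := by
    refine ⟨convex_univ, ?_⟩
    intro a _ c _ p q hp hq hpq
    have := hc.2 (Set.mem_univ (y + a • (z - y))) (Set.mem_univ (y + c • (z - y))) hp hq hpq
    have e : y + (p • a + q • c) • (z - y)
        = p • (y + a • (z - y)) + q • (y + c • (z - y)) := by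
      have hp' : p = 1 - q := by linarith
      subst hp'
      simp only [smul_eq_mul]
      module
    simpa only [e] using this
  have hd := aux_line_deriv f f' hf' y (z - y) 0
  have := hφ.le_slope_of_hasDerivAt (Set.mem_univ 0) (Set.mem_univ 1) one_pos hd
  simp [slope] at this
  linarith

lemma aux_descent (f : E → ℝ) (f' : E → E)
    (hf' : ∀ z, HasGradientAt f (f' z) z) (L : NNReal) (hL : LipschitzWith L f') (y x : E) :
    f x ≤ f y + inner ℝ (f' y) (x - y) + L / 2 * ‖x - y‖ ^ 2 := by
  set d := x - y with hd
  have hD : ∀ s : ℝ, HasDerivAt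
      (fun s : ℝ => f (y + s • d) - s * inner ℝ (f' y) d - s ^ 2 * (L / 2 * ‖d‖ ^ 2))
      (inner ℝ (f' (y + s • d)) d - inner ℝ (f' y) d - (2 * s) * (L / 2 * ‖d‖ ^ 2)) s := by
    intro s
    have h1 := aux_line_deriv f f' hf' y d s
    have h2 := (hasDerivAt_id s).mul_const (inner ℝ (f' y) d)
    have h3 := (hasDerivAt_pow 2 s).mul_const ((L : ℝ) / 2 * ‖d‖ ^ 2)
    have := (h1.sub h2).sub h3
    exact this.congr_deriv (by simp)
  have hanti := antitoneOn_of_deriv_nonpos (convex_Icc (0:ℝ) 1)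
    (fun s _ => (hD s).continuousAt.continuousWithinAt)
    (fun s _ => (hD s).differentiableAt.differentiableWithinAt)
    (by
      intro s hs
      rw [interior_Icc] at hs
      rw [(hD s).deriv, ← inner_sub_left]
      have h1 := real_inner_le_norm (f' (y + s • d) - f' y) d
      have h2 := hL.norm_sub_le (y + s • d) y
      rw [add_sub_cancel_left, norm_smul, Real.norm_of_nonneg hs.1.le] at h2
      have h3 := mul_le_mul_of_nonneg_right h2 (norm_nonneg d)
      nlinarith)
  have := hanti (Set.left_mem_Icc.2 zero_le_one) (Set.right_mem_Icc.2 zero_le_one) zero_le_one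
  have e : y + d = x := by simp [hd]
  simp [e] at this
  linarith

lemma aux_prox (g : E → ℝ) (hg : ConvexOn ℝ Set.univ g) (γ : ℝ) (hγ : 0 < γ) (u p : E)
    (hp : IsMinOn (fun w => g w + ‖w - u‖ ^ 2 / (2 * γ)) Set.univ p) (z : E) :
    g p ≤ g z + inner ℝ (p - u) (z - p) / γ := by
  have key : ∀ s : ℝ, 0 < s → s < 1 →
      0 ≤ (g z + inner ℝ (p - u) (z - p) / γ - g p) + s * (‖z - p‖ ^ 2 / (2 * γ)) := by
    intro s hs hs1
    have h1 : g p + ‖p - u‖ ^ 2 / (2 * γ)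
        ≤ g ((1 - s) • p + s • z) + ‖((1 - s) • p + s • z) - u‖ ^ 2 / (2 * γ) :=
      hp (Set.mem_univ ((1 - s) • p + s • z))
    have h2 := hg.2 (Set.mem_univ p) (Set.mem_univ z) (by linarith : 0 ≤ 1 - s) hs.le (by ring)
    have e : ((1 - s) • p + s • z) - u = (p - u) + s • (z - p) := by module
    rw [e, norm_add_sq_real, inner_smul_right, norm_smul, Real.norm_of_nonneg hs.le] at h1
    simp only [smul_eq_mul] at h2
    have e2 : (‖p - u‖ ^ 2 + 2 * (s * inner ℝ (p - u) (z - p)) + (s * ‖z - p‖) ^ 2) / (2 * γ)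
       = ‖p - u‖ ^ 2 / (2 * γ) + s * (inner ℝ (p - u) (z - p) / γ)
         + s * (s * (‖z - p‖ ^ 2 / (2 * γ))) := by
      field_simp
    rw [e2] at h1
    refine le_of_mul_le_mul_left ?_ hs
    linarith
  have hc : 0 ≤ ‖z - p‖ ^ 2 / (2 * γ) := by positivity
  generalize ‖z - p‖ ^ 2 / (2 * γ) = c at key hc
  by_contra hcon
  push Not at hcon
  obtain ⟨a, ha⟩ : ∃ a, a = g p - (g z + inner ℝ (p - u) (z - p) / γ) := ⟨_, rfl⟩
  have hapos : 0 < a := by linarith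
  have h := key (a / (2 * (c + a))) (by positivity) (by
    rw [div_lt_one (by positivity)]; linarith)
  have h2 : a / (2 * (c + a)) * c ≤ a / 2 := by
    rw [div_mul_eq_mul_div, div_le_div_iff₀ (by positivity) (by positivity)]
    nlinarith
  linarith

lemma aux_step (f : E → ℝ) (f' : E → E) (hc : ConvexOn ℝ Set.univ f)
    (hf' : ∀ z, HasGradientAt f (f' z) z) (L : NNReal) (hL : LipschitzWith L f')
    (g : E → ℝ) (hg : ConvexOn ℝ Set.univ g) (γ : ℝ) (hγ : 0 < γ) (y p : E)
    (hp : IsMinOn (fun w => g w + ‖w - (y - γ • f' y)‖ ^ 2 / (2 * γ)) Set.univ p) (z : E) :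
    f p + g p + ‖p - z‖ ^ 2 / (2 * γ) + (1 - γ * L) / (2 * γ) * ‖p - y‖ ^ 2
      ≤ f z + g z + ‖y - z‖ ^ 2 / (2 * γ) := by
  have h1 := aux_convex f f' hc hf' y z
  have h2 := aux_descent f f' hf' L hL y p
  have h3 := aux_prox g hg γ hγ _ p hp z
  have e1 : p - (y - γ • f' y) = (p - y) + γ • f' y := by module
  rw [e1, inner_add_left, real_inner_smul_left, add_div, mul_div_cancel_left₀ _ hγ.ne'] at h3
  have e2 : inner ℝ (f' y) (z - y) = inner ℝ (f' y) (z - p) + inner ℝ (f' y) (p - y) := by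
    rw [← inner_add_right]; congr 1; abel
  have e3 : ‖y - z‖ ^ 2 = ‖p - y‖ ^ 2 + 2 * inner ℝ (p - y) (z - p) + ‖p - z‖ ^ 2 := by
    rw [norm_sub_rev y z, norm_sub_rev p z, ← norm_add_sq_real]; congr 2; abel
  have e4 : ‖y - z‖ ^ 2 / (2 * γ) - ‖p - z‖ ^ 2 / (2 * γ)
      - (1 - γ * L) / (2 * γ) * ‖p - y‖ ^ 2
      = inner ℝ (p - y) (z - p) / γ + L / 2 * ‖p - y‖ ^ 2 := by
    rw [e3]; field_simp; ring
  linarith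

/-- The one-step estimate with the averaged comparison point. -/
lemma aux_step_t (f : E → ℝ) (f' : E → E) (hc : ConvexOn ℝ Set.univ f)
    (hf' : ∀ z, HasGradientAt f (f' z) z) (L : NNReal) (hL : LipschitzWith L f')
    (g : E → ℝ) (hg : ConvexOn ℝ Set.univ g) (γ : ℝ) (hγ : 0 < γ) (y p : E)
    (hp : IsMinOn (fun w => g w + ‖w - (y - γ • f' y)‖ ^ 2 / (2 * γ)) Set.univ p)
    (x xs : E) (t : ℝ) (ht : 1 ≤ t) :
    t ^ 2 * (f p + g p - (f xs + g xs)) + ‖t • p - (t - 1) • x - xs‖ ^ 2 / (2 * γ)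
      + (1 - γ * L) / (2 * γ) * t ^ 2 * ‖p - y‖ ^ 2
      ≤ (t ^ 2 - t) * (f x + g x - (f xs + g xs))
        + ‖t • y - (t - 1) • x - xs‖ ^ 2 / (2 * γ) := by
  have ht0 : 0 < t := by linarith
  have h := aux_step f f' hc hf' L hL g hg γ hγ y p hp ((1 - t⁻¹) • x + t⁻¹ • xs)
  have hi : t⁻¹ ≤ 1 := inv_le_one_of_one_le₀ ht
  have hf1 := hc.2 (Set.mem_univ x) (Set.mem_univ xs) (by linarith : 0 ≤ 1 - t⁻¹)
    (by positivity : 0 ≤ t⁻¹) (by ring)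
  have hg1 := hg.2 (Set.mem_univ x) (Set.mem_univ xs) (by linarith : 0 ≤ 1 - t⁻¹)
    (by positivity : 0 ≤ t⁻¹) (by ring)
  have en : ∀ w : E, ‖t • w - (t - 1) • x - xs‖ ^ 2
      = t ^ 2 * ‖w - ((1 - t⁻¹) • x + t⁻¹ • xs)‖ ^ 2 := by
    intro w
    have : t • w - (t - 1) • x - xs = t • (w - ((1 - t⁻¹) • x + t⁻¹ • xs)) := by
      rw [smul_sub, smul_add, smul_smul, smul_smul, mul_sub, mul_inv_cancel₀ ht0.ne']
      module
    rw [this, norm_smul, Real.norm_of_nonneg ht0.le, mul_pow]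
  rw [en, en]
  simp only [smul_eq_mul] at hf1 hg1
  have h' := mul_le_mul_of_nonneg_left (h.trans (add_le_add_left (add_le_add hf1 hg1) _))
    (sq_nonneg t)
  have e : t ^ 2 * t⁻¹ = t := by field_simp
  have e5 : t ^ 2 * ((1 - t⁻¹) * f x + t⁻¹ * f xs + ((1 - t⁻¹) * g x + t⁻¹ * g xs))
      = (t ^ 2 - t) * (f x + g x) + t * (f xs + g xs) := by
    linear_combination (f xs + g xs - f x - g x) * e
  rw [mul_add _ (_ + _ + _) (‖y - _‖ ^ 2 / _), e5] at h'
  simp only [mul_div_assoc]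
  linarith

end helpers

/-- Generic functional bound for the provisionally accelerated proximal gradient. -/
theorem provisional_generic_bound {n : ℕ}
    (f : EuclideanSpace ℝ (Fin n) → ℝ) (f' : EuclideanSpace ℝ (Fin n) → EuclideanSpace ℝ (Fin n))
    (hf_cvx : ConvexOn ℝ Set.univ f)
    (hf' : ∀ z, HasGradientAt f (f' z) z)
    (L : NNReal) (hL : LipschitzWith L f')
    (g : EuclideanSpace ℝ (Fin n) → ℝ)
    (hg_cvx : ConvexOn ℝ Set.univ g) (hg_lsc : LowerSemicontinuous g)
    (γ : ℝ) (hγ : 0 < γ)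
    (prox : EuclideanSpace ℝ (Fin n) → EuclideanSpace ℝ (Fin n))
    (hprox : ∀ u, IsMinOn (fun w => g w + ‖w - u‖ ^ 2 / (2 * γ)) Set.univ (prox u))
    (F : EuclideanSpace ℝ (Fin n) → ℝ) (hF : ∀ z, F z = f z + g z)
    (xstar : EuclideanSpace ℝ (Fin n)) (hxstar : IsMinOn F Set.univ xstar)
    (t : ℕ → ℝ) (ht0 : t 0 = 1) (htpos : ∀ k, 1 ≤ t k)
    (htrec : ∀ k, t (k + 1) ^ 2 - t (k + 1) ≤ t k ^ 2)
    (b : ℕ → Bool)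
    (x y : ℕ → EuclideanSpace ℝ (Fin n))
    (hy0 : y 0 = x 0)
    (hy : ∀ k ≥ 1, y k = if b k then
        x k + ((t (k - 1) - 1) / t k) • (x k - x (k - 1)) else x k)
    (hx : ∀ k, x (k + 1) = prox (y k - γ • f' (y k))) :
    ∀ N : ℕ,
      t N ^ 2 * (F (x (N + 1)) - F xstar)
        ≤ -(∑ k ∈ Finset.range (N + 1), (1 - γ * L) / (2 * γ) * t k ^ 2 * ‖x (k + 1) - y k‖ ^ 2)
          + ‖x 0 - xstar‖ ^ 2 / (2 * γ)
          + ∑ k ∈ Finset.Icc 1 N,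
              (1 - (if b k then (1 : ℝ) else 0)) * ‖x k - xstar‖ ^ 2 / (2 * γ) := by
  have hprox' : ∀ k, IsMinOn (fun w => g w + ‖w - (y k - γ • f' (y k))‖ ^ 2 / (2 * γ))
      Set.univ (x (k + 1)) := fun k => by rw [hx k]; exact hprox _
  have hstep := fun k => aux_step_t f f' hf_cvx hf' L hL g hg_cvx γ hγ (y k) (x (k + 1))
    (hprox' k) (x k) xstar (t k) (htpos k)
  simp only [← hF] at hstep
  have hv : ∀ k, 0 ≤ F (x k) - F xstar := fun k => sub_nonneg.2 (hxstar (Set.mem_univ (x k)))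
  have main : ∀ N : ℕ,
      t N ^ 2 * (F (x (N + 1)) - F xstar)
        + ‖t N • x (N + 1) - (t N - 1) • x N - xstar‖ ^ 2 / (2 * γ)
        ≤ -(∑ k ∈ Finset.range (N + 1),
            (1 - γ * L) / (2 * γ) * t k ^ 2 * ‖x (k + 1) - y k‖ ^ 2)
          + ‖x 0 - xstar‖ ^ 2 / (2 * γ)
          + ∑ k ∈ Finset.Icc 1 N,
              (1 - (if b k then (1 : ℝ) else 0)) * ‖x k - xstar‖ ^ 2 / (2 * γ) := by
    intro N
    induction N with
    | zero =>
      have h := hstep 0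
      simp [ht0, hy0] at h ⊢
      linarith
    | succ N ih =>
      rw [Finset.sum_range_succ, Finset.sum_Icc_succ_top (by omega)]
      have h := hstep (N + 1)
      have hm := mul_le_mul_of_nonneg_right (htrec N) (hv (N + 1))
      have hyN := hy (N + 1) (by omega)
      have htp : 0 < t (N + 1) := by linarith [htpos (N + 1)]
      rw [Nat.add_sub_cancel] at hyN
      cases hb : b (N + 1) with
      | true =>
        simp only [hb, if_true] at hyN ⊢
        have e : t (N + 1) • y (N + 1) - (t (N + 1) - 1) • x (N + 1) - xstar
            = t N • x (N + 1) - (t N - 1) • x N - xstar := by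
          rw [hyN, smul_add, smul_smul, mul_div_cancel₀ _ htp.ne']
          module
        rw [e] at h
        simp only [sub_self, zero_mul, zero_div]
        linarith
      | false =>
        simp only [hb, Bool.false_eq_true, if_false] at hyN ⊢
        have e : t (N + 1) • y (N + 1) - (t (N + 1) - 1) • x (N + 1) - xstar
            = x (N + 1) - xstar := by
          rw [hyN]; module
        rw [e] at h
        have hpos : 0 ≤ ‖t N • x (N + 1) - (t N - 1) • x N - xstar‖ ^ 2 / (2 * γ) := by
          positivity
        simp only [sub_zero, one_mul]
        linarith
  intro N
  have hpos : 0 ≤ ‖t N • x (N + 1) - (t N - 1) • x N - xstar‖ ^ 2 / (2 * γ) := by positivity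
  linarith [main N]
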